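/- arXiv:1909.07675 — 2 statements merged into one kernel-verified Lean document; each statement's English description precedes it below -/
import Mathlib

section
/- For every natural number n ≥ 1, one has d(2n−2, 2) = c_n − c_{n−1}. -/
open Finset

/-- Step value: `true` is an up-step (+1), `false` a down-step (−1). -/
def dyckStep (b : Bool) : ℤ := if b then 1 else -1

/-- Sum of the first `k` steps of the path `w`. -/
def dyckPSum {m : ℕ} (w : Fin m → Bool) (k : ℕ) : ℤ :=
  ∑ t ∈ Finset.univ.filter (fun t : Fin m => (t : ℕ) < k), dyckStep (w t)

/-- `dyckD i j`: the number of lattice paths of length `i` from `(0,0)` to `(i,j)`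
using steps `(1,1)` and `(1,-1)` that never go below the x-axis; equivalently the
number of `±1`-lists of length `i` all of whose partial sums are nonnegative and
whose total sum is `j`. -/
def dyckD (i j : ℕ) : ℕ :=
  (Finset.univ.filter (fun w : Fin i → Bool =>
    (∀ k ≤ i, 0 ≤ dyckPSum w k) ∧ dyckPSum w i = (j : ℤ))).card

theorem dyckPSum_snoc_of_le {i : ℕ} (w : Fin i → Bool) (b : Bool) {k : ℕ} (hk : k ≤ i) :
    dyckPSum (Fin.snoc w b : Fin (i + 1) → Bool) k = dyckPSum w k := by
  simp [dyckPSum, Finset.sum_filter, Fin.sum_univ_castSucc, hk]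

theorem dyckPSum_snoc_succ {i : ℕ} (w : Fin i → Bool) (b : Bool) :
    dyckPSum (Fin.snoc w b : Fin (i + 1) → Bool) (i + 1) = dyckPSum w i + dyckStep b := by
  simp [dyckPSum, Finset.sum_filter, Fin.sum_univ_castSucc]

/-- A path obtained by appending a step is nonnegative with endpoint `j ≥ 0` exactly when
the shorter path is nonnegative and ends at `j` minus the last step. -/
theorem dyck_snoc_iff {i : ℕ} (w : Fin i → Bool) (b : Bool) (j : ℕ) :
    ((∀ k ≤ i + 1, 0 ≤ dyckPSum (Fin.snoc w b : Fin (i + 1) → Bool) k) ∧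
      dyckPSum (Fin.snoc w b : Fin (i + 1) → Bool) (i + 1) = (j : ℤ)) ↔
    (∀ k ≤ i, 0 ≤ dyckPSum w k) ∧ dyckPSum w i + dyckStep b = (j : ℤ) := by
  rw [dyckPSum_snoc_succ]
  refine and_congr_left fun hj => ⟨fun h k hk => ?_, fun h k hk => ?_⟩
  · simpa [dyckPSum_snoc_of_le w b hk] using h k (by omega)
  · rcases Nat.le_succ_iff.mp hk with hk | rfl
    · simpa [dyckPSum_snoc_of_le w b hk] using h k hk
    · rw [Nat.succ_eq_add_one, dyckPSum_snoc_succ, hj]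
      positivity

theorem dyckD_succ_eq_add (i j : ℕ) :
    dyckD (i + 1) j =
      #{w : Fin i → Bool | (∀ k ≤ i, 0 ≤ dyckPSum w k) ∧ dyckPSum w i + 1 = (j : ℤ)} +
        dyckD i (j + 1) := by
  have hfalse (w : Fin i → Bool) :
      dyckPSum w i + dyckStep false = (j : ℤ) ↔ dyckPSum w i = ((j + 1 : ℕ) : ℤ) := by
    simp only [dyckStep, Bool.false_eq_true, if_false]
    omega
  simp only [dyckD, Finset.card_filter]
  rw [← (Fin.snocEquiv fun _ : Fin (i + 1) => Bool).sum_comp, Fintype.sum_prod_type,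
    Fintype.sum_bool]
  simp only [Fin.snocEquiv, Equiv.coe_fn_mk, dyck_snoc_iff, hfalse]
  simp [dyckStep]

theorem dyckD_succ_zero (i : ℕ) : dyckD (i + 1) 0 = dyckD i 1 := by
  rw [dyckD_succ_eq_add, Nat.add_eq_right, Finset.card_eq_zero, Finset.filter_eq_empty_iff]
  rintro w - ⟨h, h'⟩
  have := h i le_rfl
  push_cast at h'
  omega

theorem dyckD_succ_succ (i j : ℕ) :
    dyckD (i + 1) (j + 1) = dyckD i j + dyckD i (j + 2) := by
  rw [dyckD_succ_eq_add]
  simp [dyckD, add_assoc]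

theorem dyckD_zero_left (j : ℕ) : dyckD 0 j = if j = 0 then 1 else 0 := by
  rcases j with _ | j
  · simp [dyckD, dyckPSum]
  · have : (0 : ℤ) ≠ (j : ℤ) + 1 := by omega
    simp [dyckD, dyckPSum, this]

/-- The ballot formula: with `u` up-steps, `d(i, j) = C(i, u) - C(i, u + 1)`. -/
theorem dyckD_add_choose (i j u : ℕ) (h : 2 * u = i + j) :
    dyckD i j + i.choose (u + 1) = i.choose u := by
  induction i generalizing j u with
  | zero =>
    rcases u with _ | u
    · obtain rfl : j = 0 := by omega
      simp [dyckD_zero_left]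
    · have : j ≠ 0 := by omega
      simp [dyckD_zero_left, this]
  | succ i ih =>
    obtain ⟨v, rfl⟩ : ∃ v, u = v + 1 := ⟨u - 1, by omega⟩
    rcases j with _ | j
    · have h₁ := ih 1 (v + 1) (by omega)
      have h₂ : i.choose v = i.choose (v + 1) := Nat.choose_symm_of_eq_add (by omega)
      rw [dyckD_succ_zero, Nat.choose_succ_succ, Nat.choose_succ_succ i v]
      simp only [Nat.succ_eq_add_one]
      omega
    · have h₁ := ih j v (by omega)
      have h₂ := ih (j + 2) (v + 1) (by omega)
      rw [dyckD_succ_succ, Nat.choose_succ_succ, Nat.choose_succ_succ i v]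
      simp only [Nat.succ_eq_add_one]
      omega

theorem dyckD_two_mul_zero (n : ℕ) : dyckD (2 * n) 0 = catalan n := by
  have h₁ := dyckD_add_choose (2 * n) 0 n rfl
  have h₂ := Nat.choose_succ_right_eq (2 * n) n
  have h₃ := succ_mul_catalan_eq_centralBinom n
  rw [Nat.centralBinom] at h₃
  rw [show 2 * n - n = n by omega] at h₂
  refine Nat.eq_of_mul_eq_mul_left n.succ_pos ?_
  rw [Nat.succ_eq_add_one, h₃]
  nlinarith

/-- For `n ≥ 1`, `d(2n−2, 2) = cₙ − cₙ₋₁`. -/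
theorem dyckD_isoline_two (n : ℕ) (hn : 1 ≤ n) :
    (dyckD (2 * n - 2) 2 : ℤ) = catalan n - catalan (n - 1) := by
  obtain ⟨m, rfl⟩ : ∃ m, n = m + 1 := ⟨n - 1, by omega⟩
  have h : dyckD (2 * m + 2) 0 = dyckD (2 * m) 0 + dyckD (2 * m) 2 := by
    rw [dyckD_succ_zero, dyckD_succ_succ]
  rw [← dyckD_two_mul_zero, ← dyckD_two_mul_zero, Nat.add_sub_cancel,
    show 2 * (m + 1) - 2 = 2 * m by omega, show 2 * (m + 1) = 2 * m + 2 by omega, h]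
  push_cast
  ring
end

section
/- For all natural numbers m and j, the number of lattice paths of length m with steps (1,1) and (1,−1) that start at height j, end at height 0, and never go below the x-axis equals d(m, j); that is, the inverse dynamics obtained by reversing paths satisfies d̄(m, j) = d(m, j). -/
open Finset

/-- `dyckDBar m j`: the number of lattice paths of length `m` with steps `(1,1)`
and `(1,−1)` that start at height `j`, end at height `0`, and never go below the
x-axis. -/
def dyckDBar (m j : ℕ) : ℕ :=
  (Finset.univ.filter (fun w : Fin m → Bool =>
    (∀ k ≤ m, 0 ≤ (j : ℤ) + dyckPSum w k) ∧ (j : ℤ) + dyckPSum w m = 0)).card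

theorem dyckStep_not (b : Bool) : dyckStep (!b) = -dyckStep b := by
  cases b <;> rfl

/-- Reverse a path: read its steps backwards and flip each of them. -/
def dyckRev {m : ℕ} (w : Fin m → Bool) : Fin m → Bool := fun t => !w t.rev

theorem dyckRev_dyckRev {m : ℕ} (w : Fin m → Bool) : dyckRev (dyckRev w) = w := by
  funext t
  simp [dyckRev]

theorem dyckPSum_zero {m : ℕ} (w : Fin m → Bool) : dyckPSum w 0 = 0 := by
  simp [dyckPSum]

theorem dyckPSum_dyckRev {m : ℕ} (w : Fin m → Bool) {k : ℕ} (hk : k ≤ m) :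
    dyckPSum (dyckRev w) k = dyckPSum w (m - k) - dyckPSum w m := by
  simp only [dyckPSum, Finset.sum_filter]
  rw [← Equiv.sum_comp Fin.revPerm, ← Finset.sum_sub_distrib]
  refine Finset.sum_congr rfl fun t _ => ?_
  have ht := t.isLt
  simp only [Fin.revPerm_apply, dyckRev, Fin.rev_rev, dyckStep_not, Fin.val_rev, ht, if_true]
  split_ifs <;> omega

/-- The inverse dynamics coincides with the dynamics: `d̄(m, j) = d(m, j)`. -/
theorem dyckDBar_eq_dyckD (m j : ℕ) : dyckDBar m j = dyckD m j := by
  refine Finset.card_nbij' dyckRev dyckRev ?_ ?_ (fun w _ => dyckRev_dyckRev w)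
    (fun w _ => dyckRev_dyckRev w)
  · intro w hw
    simp only [coe_filter, mem_univ, true_and, Set.mem_ofPred_eq] at hw ⊢
    obtain ⟨hnn, hend⟩ := hw
    refine ⟨fun k hk => ?_, ?_⟩
    · have := hnn (m - k) (Nat.sub_le m k)
      rw [dyckPSum_dyckRev w hk]
      linarith
    · rw [dyckPSum_dyckRev w le_rfl, Nat.sub_self, dyckPSum_zero]
      linarith
  · intro w hw
    simp only [coe_filter, mem_univ, true_and, Set.mem_ofPred_eq] at hw ⊢
    obtain ⟨hnn, hend⟩ := hw
    refine ⟨fun k hk => ?_, ?_⟩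
    · have := hnn (m - k) (Nat.sub_le m k)
      rw [dyckPSum_dyckRev w hk]
      linarith
    · rw [dyckPSum_dyckRev w le_rfl, Nat.sub_self, dyckPSum_zero]
      linarith
end
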